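/- Let n ≥ 6 be an even integer. Then in the dicyclic group Dic_{4n}: the number of MSTD subsets of cardinality 2n satisfies S_{Dic_{4n}}(2n) ≥ (n+1)(7·2^{n−3} − 4); the number of MDTS subsets of cardinality 2n satisfies D_{Dic_{4n}}(2n) ≥ 2(n+1); and the number of balanced subsets of cardinality 2n satisfies B_{Dic_{4n}}(2n) ≥ (n+1)·Σ_{i=3, i odd}^{n+3} C(2n−i, n−3). -/

import Mathlib

open Finset Pointwise

/-- A finset of a group is MSTD if its sumset `A * A` is larger than its
difference set `A / A = {a₁ * a₂⁻¹}`. -/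
def IsMSTD {G : Type*} [Group G] [DecidableEq G] (A : Finset G) : Prop :=
  (A / A).card < (A * A).card

/-- A finset of a group is MDTS if its sumset is smaller than its difference set. -/
def IsMDTS {G : Type*} [Group G] [DecidableEq G] (A : Finset G) : Prop :=
  (A * A).card < (A / A).card

/-- A finset of a group is balanced if its sumset and difference set have equal size. -/
def IsBalanced {G : Type*} [Group G] [DecidableEq G] (A : Finset G) : Prop :=
  (A * A).card = (A / A).card

section DicyclicSet

open QuaternionGroup

variable {n : ℕ}

/-- The subset `{a i | i ∈ R} ∪ {xa j | j ∈ F}` of the dicyclic group. -/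
def dicyclicSet (R F : Finset (ZMod (2 * n))) : Finset (QuaternionGroup n) :=
  R.image a ∪ F.image xa

@[simp]
theorem a_mem_dicyclicSet {R F : Finset (ZMod (2 * n))} {i : ZMod (2 * n)} :
    a i ∈ dicyclicSet R F ↔ i ∈ R := by
  simp [dicyclicSet]

@[simp]
theorem xa_mem_dicyclicSet {R F : Finset (ZMod (2 * n))} {i : ZMod (2 * n)} :
    xa i ∈ dicyclicSet R F ↔ i ∈ F := by
  simp [dicyclicSet]

theorem card_dicyclicSet (R F : Finset (ZMod (2 * n))) :
    (dicyclicSet R F).card = R.card + F.card := by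
  rw [dicyclicSet, card_union_of_disjoint, card_image_of_injective, card_image_of_injective]
  · intro i j h; simpa using h
  · intro i j h; simpa using h
  · simp [Finset.disjoint_left]

theorem dicyclicSet_injective :
    Function.Injective fun p : Finset (ZMod (2 * n)) × Finset (ZMod (2 * n)) =>
      dicyclicSet p.1 p.2 := by
  rintro ⟨R, F⟩ ⟨R', F'⟩ h
  simp only at h
  ext i
  · rw [← a_mem_dicyclicSet (F := F), h, a_mem_dicyclicSet]
  · rw [← xa_mem_dicyclicSet (R := R), h, xa_mem_dicyclicSet]

theorem card_le_ncard_of_dicyclicSet_mem [NeZero n] {P : Finset (QuaternionGroup n) → Prop}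
    (T : Finset (Finset (ZMod (2 * n)) × Finset (ZMod (2 * n))))
    (h : ∀ p ∈ T, P (dicyclicSet p.1 p.2)) : T.card ≤ {A | P A}.ncard := by
  rw [← card_image_of_injective T dicyclicSet_injective, ← Set.ncard_coe_finset]
  refine Set.ncard_le_ncard (fun A hA => ?_) (Set.toFinite _)
  obtain ⟨p, hp, rfl⟩ := by simpa only [coe_image, Set.mem_image] using hA
  exact h p hp

theorem natCast_add_self_zmod_two_mul : (n : ZMod (2 * n)) + n = 0 := by
  have h := ZMod.natCast_self (2 * n)
  push_cast at h
  rw [← h]; ring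

theorem neg_natCast_zmod_two_mul : -(n : ZMod (2 * n)) = n :=
  neg_eq_of_add_eq_zero_left natCast_add_self_zmod_two_mul

theorem natCast_zmod_two_mul_ne_zero [NeZero n] : (n : ZMod (2 * n)) ≠ 0 := by
  rw [Ne, ZMod.natCast_eq_zero_iff]
  intro h
  have := Nat.le_of_dvd (Nat.pos_of_neZero n) h
  have := Nat.pos_of_neZero n
  omega

theorem inv_a (i : ZMod (2 * n)) : (a i)⁻¹ = a (-i) :=
  inv_eq_of_mul_eq_one_right (by rw [a_mul_a, add_neg_cancel, a_zero])

theorem inv_xa (i : ZMod (2 * n)) : (xa i)⁻¹ = xa ((n : ZMod (2 * n)) + i) :=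
  inv_eq_of_mul_eq_one_right (by
    rw [xa_mul_xa, ← add_assoc, natCast_add_self_zmod_two_mul, zero_add, sub_self, a_zero])

section Membership

variable {R F : Finset (ZMod (2 * n))} {x i j : ZMod (2 * n)}

theorem a_mem_mul_of_left (hi : i ∈ R) (hj : j ∈ R) (h : i + j = x) :
    a x ∈ dicyclicSet R F * dicyclicSet R F :=
  mem_mul.2 ⟨a i, by simpa, a j, by simpa, by simp [h]⟩

theorem a_mem_mul_of_right (hi : i ∈ F) (hj : j ∈ F) (h : n + j - i = x) :
    a x ∈ dicyclicSet R F * dicyclicSet R F :=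
  mem_mul.2 ⟨xa i, by simpa, xa j, by simpa, by simp [h]⟩

theorem xa_mem_mul_of_sub (hi : i ∈ R) (hj : j ∈ F) (h : j - i = x) :
    xa x ∈ dicyclicSet R F * dicyclicSet R F :=
  mem_mul.2 ⟨a i, by simpa, xa j, by simpa, by simp [h]⟩

theorem xa_mem_mul_of_add (hi : i ∈ R) (hj : j ∈ F) (h : j + i = x) :
    xa x ∈ dicyclicSet R F * dicyclicSet R F :=
  mem_mul.2 ⟨xa j, by simpa, a i, by simpa, by simp [h]⟩

theorem a_mem_div_of_left (hi : i ∈ R) (hj : j ∈ R) (h : i - j = x) :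
    a x ∈ dicyclicSet R F / dicyclicSet R F :=
  mem_div.2 ⟨a i, by simpa, a j, by simpa, by
    rw [div_eq_mul_inv, inv_a, a_mul_a, ← h, sub_eq_add_neg]⟩

theorem xa_mem_div_of_sub (hi : i ∈ R) (hj : j ∈ F) (h : j - i = x) :
    xa x ∈ dicyclicSet R F / dicyclicSet R F :=
  mem_div.2 ⟨xa j, by simpa, a i, by simpa, by
    rw [div_eq_mul_inv, inv_a, xa_mul_a, ← h, sub_eq_add_neg]⟩

theorem xa_mem_div_of_sub_add (hi : i ∈ R) (hj : j ∈ F) (h : j - i + n = x) :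
    xa x ∈ dicyclicSet R F / dicyclicSet R F :=
  mem_div.2 ⟨a i, by simpa, xa j, by simpa, by
    rw [div_eq_mul_inv, inv_xa, a_mul_xa, ← h]; congr 1; ring⟩

end Membership

theorem eq_univ_of_a_of_xa [NeZero n] {B : Finset (QuaternionGroup n)} (ha : ∀ i, a i ∈ B)
    (hxa : ∀ i, xa i ∈ B) : B = univ := by
  ext (i | i) <;> simp [ha, hxa]

section LargeRotationPart

variable [NeZero n] {R F : Finset (ZMod (2 * n))}

theorem exists_add_eq_of_lt_card (hR : n < R.card) (x : ZMod (2 * n)) :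
    ∃ i ∈ R, ∃ j ∈ R, i + j = x := by
  by_contra! h
  have hd : Disjoint R (R.image (x - ·)) := by
    rw [Finset.disjoint_right]
    intro i hi hi'
    obtain ⟨j, hj, rfl⟩ := mem_image.1 hi
    exact h _ hi' j hj (by simp)
  have := card_le_univ (R ∪ R.image (x - ·))
  rw [card_union_of_disjoint hd, card_image_of_injective _ sub_right_injective, ZMod.card] at this
  omega

theorem exists_sub_eq_of_lt_card (hR : n < R.card) (x : ZMod (2 * n)) :
    ∃ i ∈ R, ∃ j ∈ R, i - j = x := by
  by_contra! h
  have hd : Disjoint R (R.image (x + ·)) := by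
    rw [Finset.disjoint_right]
    intro i hi hi'
    obtain ⟨j, hj, rfl⟩ := mem_image.1 hi
    exact h _ hi' j hj (by simp)
  have := card_le_univ (R ∪ R.image (x + ·))
  rw [card_union_of_disjoint hd, card_image_of_injective _ (add_right_injective x),
    ZMod.card] at this
  omega

theorem exists_sub_eq_of_ne_compl (hRF : R.card + F.card = 2 * n) (x : ZMod (2 * n))
    (h : F ≠ (R.image (x + ·))ᶜ) : ∃ i ∈ R, ∃ j ∈ F, j - i = x := by
  by_contra! h'
  refine h (eq_of_subset_of_card_le (fun j hj => ?_) ?_)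
  · rw [mem_compl, mem_image]
    rintro ⟨i, hi, rfl⟩
    exact h' i hi _ hj (by simp)
  · rw [card_compl, card_image_of_injective _ (add_right_injective x), ZMod.card]
    omega

theorem isBalanced_dicyclicSet (hR : n < R.card) (hRF : R.card + F.card = 2 * n)
    (h : ∀ x, F ≠ (R.image (x + ·))ᶜ) : IsBalanced (dicyclicSet R F) := by
  rw [IsBalanced, eq_univ_of_a_of_xa (B := _ * _) (fun x => ?_) (fun x => ?_),
    eq_univ_of_a_of_xa (B := _ / _) (fun x => ?_) (fun x => ?_)]
  · obtain ⟨i, hi, j, hj, hx⟩ := exists_sub_eq_of_lt_card hR x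
    exact a_mem_div_of_left hi hj hx
  · obtain ⟨i, hi, j, hj, hx⟩ := exists_sub_eq_of_ne_compl hRF x (h x)
    exact xa_mem_div_of_sub hi hj hx
  · obtain ⟨i, hi, j, hj, hx⟩ := exists_add_eq_of_lt_card hR x
    exact a_mem_mul_of_left hi hj hx
  · obtain ⟨i, hi, j, hj, hx⟩ := exists_sub_eq_of_ne_compl hRF x (h x)
    exact xa_mem_mul_of_sub hi hj hx

theorem isMDTS_dicyclicSet (hn : 2 ≤ n) {c : ZMod (2 * n)} (hc : c + c = 0) (y : ZMod (2 * n)) :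
    IsMDTS (dicyclicSet {c}ᶜ {y}) := by
  have hcard : n < ({c}ᶜ : Finset (ZMod (2 * n))).card := by
    rw [card_compl, ZMod.card, card_singleton]; omega
  rw [IsMDTS, eq_univ_of_a_of_xa (B := _ / _) (fun x => ?_) (fun x => ?_)]
  · refine card_lt_univ_of_notMem (x := xa (y + c)) fun h => ?_
    obtain ⟨g, hg, g', hg', h⟩ := mem_mul.1 h
    rcases g with i | i <;> rcases g' with j | j <;>
      simp only [a_mem_dicyclicSet, xa_mem_dicyclicSet, mem_compl, mem_singleton, a_mul_a,
        a_mul_xa, xa_mul_a, xa_mul_xa, xa.injEq, reduceCtorEq] at hg hg' h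
    · exact hg (by linear_combination -h + hg' - hc)
    · exact hg' (by linear_combination h - hg)
  · obtain ⟨i, hi, j, hj, hx⟩ := exists_sub_eq_of_lt_card hcard x
    exact a_mem_div_of_left hi hj hx
  · by_cases hx : y - x = c
    · refine xa_mem_div_of_sub_add (i := y - x + n) (j := y) ?_ (by simp) (by ring)
      simp [hx, natCast_zmod_two_mul_ne_zero]
    · exact xa_mem_div_of_sub (i := y - x) (j := y) (by simpa) (by simp) (by ring)

end LargeRotationPart

section Antiperiodic

/-- A subset of `ZMod (2 * n)` is antiperiodic if translation by `n` maps it to its complement. -/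
def IsAntiperiodic (R : Finset (ZMod (2 * n))) : Prop :=
  ∀ i : ZMod (2 * n), i + n ∈ R ↔ i ∉ R

variable {R F : Finset (ZMod (2 * n))}

theorem IsAntiperiodic.card_eq [NeZero n] (hR : IsAntiperiodic R) : R.card = n := by
  have h : Rᶜ = R.image (· + (n : ZMod (2 * n))) := by
    ext i
    rw [mem_compl, ← hR, mem_image]
    refine ⟨fun hi => ⟨_, hi, ?_⟩, ?_⟩
    · rw [add_assoc, natCast_add_self_zmod_two_mul, add_zero]
    · rintro ⟨j, hj, rfl⟩
      rwa [add_assoc, natCast_add_self_zmod_two_mul, add_zero]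
  have h' := congrArg card h
  rw [card_compl, card_image_of_injective _ (add_left_injective _), ZMod.card] at h'
  have := card_le_univ R
  rw [ZMod.card] at this
  omega

theorem IsAntiperiodic.exists_mem (hR : IsAntiperiodic R) (h : ZMod (2 * n)) :
    ∃ i ∈ R, i + i = h + h := by
  by_cases hh : h ∈ R
  · exact ⟨h, hh, rfl⟩
  · exact ⟨h + n, (hR h).2 hh, by
      linear_combination natCast_add_self_zmod_two_mul (n := n)⟩

theorem IsAntiperiodic.isMSTD [NeZero n] (heven : Even n) (hR : IsAntiperiodic R)
    (hF : IsAntiperiodic F) : IsMSTD (dicyclicSet R F) := by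
  have hnn := natCast_add_self_zmod_two_mul (n := n)
  rw [IsMSTD, eq_univ_of_a_of_xa (B := _ * _) (fun x => ?_) (fun x => ?_)]
  · refine card_lt_univ_of_notMem (x := a n) fun h => ?_
    obtain ⟨g, hg, g', hg', h⟩ := mem_div.1 h
    rcases g with i | i <;> rcases g' with j | j <;>
      simp only [a_mem_dicyclicSet, xa_mem_dicyclicSet, div_eq_mul_inv, inv_a, inv_xa, a_mul_a,
        a_mul_xa, xa_mul_a, xa_mul_xa, a.injEq, reduceCtorEq] at hg hg' h
    · exact (hR j).1 (by rwa [show j + n = i by linear_combination -h]) hg'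
    · exact (hF i).1 (by rwa [show i + n = j by linear_combination hnn - h]) hg
  · obtain ⟨m, rfl⟩ := ZMod.natCast_zmod_surjective x
    obtain ⟨k, rfl⟩ | hm := m.even_or_odd
    · obtain ⟨i, hi, h⟩ := hR.exists_mem k
      exact a_mem_mul_of_left hi hi (by rw [h, Nat.cast_add])
    · by_contra hx
      have hstep : ∀ f ∈ F, f + m ∈ F := fun f hf => by
        by_contra hfm
        exact hx (a_mem_mul_of_right hf ((hF _).2 hfm) (by linear_combination hnn))
      obtain ⟨f, hf, -⟩ := hF.exists_mem 0
      have hiter : ∀ k : ℕ, f + k * m ∈ F := fun k => by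
        induction k with
        | zero => simpa
        | succ k ih =>
          convert hstep _ ih using 1
          push_cast; ring
      obtain ⟨k, rfl⟩ := hm
      refine (hF f).1 ?_ hf
      convert hiter n using 2
      push_cast
      linear_combination -(k : ZMod (2 * n)) * hnn
  · obtain ⟨k, hk⟩ := heven
    obtain ⟨i, hi, h⟩ := hR.exists_mem k
    rw [← Nat.cast_add, ← hk] at h
    by_cases hx : x + i ∈ F
    · exact xa_mem_mul_of_sub hi hx (by ring)
    · refine xa_mem_mul_of_add (j := x - i) hi ?_ (by ring)
      rw [show x - i = x + i + n by linear_combination -h - hnn]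
      exact (hF _).2 hx

/-- The antiperiodic subset of `ZMod (2 * n)` that agrees with `S` on residues below `n`. -/
def antiperiodicExtension [NeZero n] (S : Finset ℕ) : Finset (ZMod (2 * n)) :=
  univ.filter fun i : ZMod (2 * n) => i.val < n ↔ i.val % n ∈ S

theorem isAntiperiodic_antiperiodicExtension [NeZero n] (S : Finset ℕ) :
    IsAntiperiodic (antiperiodicExtension (n := n) S) := by
  intro (i : ZMod (2 * n))
  have hn := Nat.pos_of_neZero n
  have hi := ZMod.val_lt i
  have hv : (n : ZMod (2 * n)).val = n := ZMod.val_natCast_of_lt (by omega)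
  simp only [antiperiodicExtension, mem_filter, mem_univ, true_and]
  rw [ZMod.val_add, hv]
  have hmod : (i.val + n) % (2 * n) % n = i.val % n := by
    rw [Nat.mod_mul_left_mod, Nat.add_mod_right]
  have hlt : (i.val + n) % (2 * n) < n ↔ ¬ i.val < n := by
    by_cases h : i.val < n
    · rw [Nat.mod_eq_of_lt (by omega)]; omega
    · rw [Nat.mod_eq_sub_mod (by omega), Nat.mod_eq_of_lt (by omega)]; omega
  rw [hmod, hlt]
  tauto

theorem antiperiodicExtension_injOn [NeZero n] :
    Set.InjOn (antiperiodicExtension (n := n)) ((range n).powerset : Set (Finset ℕ)) := by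
  have key : ∀ S ⊆ range n, ∀ k, k ∈ S ↔ k < n ∧ (k : ZMod (2 * n)) ∈ antiperiodicExtension S := by
    intro S hS k
    constructor
    · intro hk
      have hkn := mem_range.1 (hS hk)
      simp [antiperiodicExtension, ZMod.val_natCast_of_lt (show k < 2 * n by omega),
        Nat.mod_eq_of_lt hkn, hkn, hk]
    · rintro ⟨hkn, hk⟩
      simpa [antiperiodicExtension, ZMod.val_natCast_of_lt (show k < 2 * n by omega),
        Nat.mod_eq_of_lt hkn, hkn] using hk
  intro S hS T hT h
  simp only [coe_powerset, Set.mem_preimage, Set.mem_powerset_iff, coe_subset] at hS hT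
  ext k
  rw [key S hS, key T hT, h]

end Antiperiodic

theorem four_pow_le_ncard_isMSTD [NeZero n] (heven : Even n) :
    4 ^ n ≤ {A : Finset (QuaternionGroup n) | A.card = 2 * n ∧ IsMSTD A}.ncard := by
  let E := (range n).powerset.image (antiperiodicExtension (n := n))
  have hE : E.card = 2 ^ n := by
    rw [card_image_of_injOn antiperiodicExtension_injOn, card_powerset, card_range]
  have hanti : ∀ R ∈ E, IsAntiperiodic R := by
    intro R hR
    obtain ⟨S, -, rfl⟩ := mem_image.1 hR
    exact isAntiperiodic_antiperiodicExtension S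
  calc 4 ^ n = (E ×ˢ E).card := by rw [card_product, hE, ← mul_pow]; norm_num
    _ ≤ _ := card_le_ncard_of_dicyclicSet_mem _ fun p hp => by
      have h₁ := hanti _ (mem_product.1 hp).1
      have h₂ := hanti _ (mem_product.1 hp).2
      exact ⟨by rw [card_dicyclicSet, h₁.card_eq, h₂.card_eq, two_mul], h₁.isMSTD heven h₂⟩

theorem four_mul_le_ncard_isMDTS [NeZero n] (hn : 2 ≤ n) :
    4 * n ≤ {A : Finset (QuaternionGroup n) | A.card = 2 * n ∧ IsMDTS A}.ncard := by
  let C : Finset (Finset (ZMod (2 * n))) := ({0, (n : ZMod (2 * n))} : Finset _).image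
    fun c => {c}ᶜ
  let Y : Finset (Finset (ZMod (2 * n))) := univ.image fun y => {y}
  have hC : C.card = 2 := by
    rw [card_image_of_injective _ fun c d h => singleton_injective (compl_injective h),
      card_pair natCast_zmod_two_mul_ne_zero.symm]
  have hY : Y.card = 2 * n := by
    rw [card_image_of_injective _ singleton_injective, card_univ, ZMod.card]
  calc 4 * n = (C ×ˢ Y).card := by rw [card_product, hC, hY]; ring
    _ ≤ _ := card_le_ncard_of_dicyclicSet_mem _ ?_
  rintro ⟨R, F⟩ hp
  obtain ⟨hR, hF⟩ := mem_product.1 hp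
  obtain ⟨c, hc, rfl⟩ := mem_image.1 hR
  obtain ⟨y, -, rfl⟩ := mem_image.1 hF
  refine ⟨?_, isMDTS_dicyclicSet hn ?_ y⟩
  · rw [card_dicyclicSet, card_compl, ZMod.card, card_singleton, card_singleton]
    omega
  · rcases mem_insert.1 hc with rfl | hc
    · simp
    · rw [mem_singleton.1 hc, natCast_add_self_zmod_two_mul]

theorem choose_mul_le_ncard_isBalanced [NeZero n] :
    (2 * n).choose (n - 1) * ((2 * n).choose (n - 1) - 2 * n) ≤
      {A : Finset (QuaternionGroup n) | A.card = 2 * n ∧ IsBalanced A}.ncard := by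
  have hn := Nat.pos_of_neZero n
  let P := powersetCard (n + 1) (univ : Finset (ZMod (2 * n)))
  let Q := powersetCard (n - 1) (univ : Finset (ZMod (2 * n)))
  let bad := (P ×ˢ (univ : Finset (ZMod (2 * n)))).image
    fun p => (p.1, (p.1.image (p.2 + ·))ᶜ)
  have hP : P.card = (2 * n).choose (n - 1) := by
    rw [card_powersetCard, card_univ, ZMod.card, Nat.choose_symm_of_eq_add (b := n - 1) (by omega)]
  have hQ : Q.card = (2 * n).choose (n - 1) := by
    rw [card_powersetCard, card_univ, ZMod.card]
  have hbad : bad.card ≤ (2 * n).choose (n - 1) * (2 * n) := by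
    refine card_image_le.trans_eq ?_
    rw [card_product, hP, card_univ, ZMod.card]
  have hsdiff := le_card_sdiff bad (P ×ˢ Q)
  rw [card_product, hP, hQ] at hsdiff
  calc _ ≤ (P ×ˢ Q \ bad).card := by rw [Nat.mul_sub]; omega
    _ ≤ _ := card_le_ncard_of_dicyclicSet_mem _ ?_
  rintro ⟨R, F⟩ hp
  obtain ⟨hp, hnb⟩ := mem_sdiff.1 hp
  obtain ⟨hRP, hF⟩ := mem_product.1 hp
  have hR := (mem_powersetCard.1 hRP).2
  have hF := (mem_powersetCard.1 hF).2
  simp only at hRP hR hF ⊢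
  have hRF : R.card + F.card = 2 * n := by omega
  have hnR : n < R.card := by omega
  refine ⟨by rw [card_dicyclicSet, hRF], isBalanced_dicyclicSet hnR hRF fun x hx => hnb ?_⟩
  exact mem_image.2 ⟨(R, x), mem_product.2 ⟨hRP, mem_univ x⟩, congrArg (R, ·) hx.symm⟩

theorem choose_two_mul_mono {r s : ℕ} (hrs : r ≤ s) (hs : s ≤ n) :
    (2 * n).choose r ≤ (2 * n).choose s := by
  induction s, hrs using Nat.le_induction with
  | base => rfl
  | succ s _ ih =>
    exact (ih (by omega)).trans (Nat.choose_le_succ_of_lt_half_left (by omega))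

theorem le_choose_two_mul_sub_one (hn : 6 ≤ n) :
    (n + 1) * (n + 1) + 2 * n ≤ (2 * n).choose (n - 1) := by
  calc (n + 1) * (n + 1) + 2 * n ≤ n * (2 * n - 1) := by
        zify [show 1 ≤ 2 * n by omega]
        nlinarith
    _ = (2 * n).choose 2 := by
        rw [Nat.choose_two_right, mul_assoc, Nat.mul_div_cancel_left _ two_pos]
    _ ≤ _ := choose_two_mul_mono (by omega) (by omega)

theorem choose_two_mul_sub_le (i : ℕ) :
    (2 * n - i).choose (n - 3) ≤ (2 * n).choose (n - 1) :=
  (Nat.choose_le_choose _ (Nat.sub_le _ _)).trans (choose_two_mul_mono (by omega) (by omega))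

end DicyclicSet

theorem stmt_18 (n : ℕ) (hn : 6 ≤ n) (heven : Even n) :
    (n + 1) * (7 * 2 ^ (n - 3) - 4) ≤
        {A : Finset (QuaternionGroup n) | A.card = 2 * n ∧ IsMSTD A}.ncard ∧
    2 * (n + 1) ≤ {A : Finset (QuaternionGroup n) | A.card = 2 * n ∧ IsMDTS A}.ncard ∧
    (n + 1) * (∑ i ∈ (Finset.Icc 3 (n + 3)).filter (fun i => Odd i),
          (2 * n - i).choose (n - 3)) ≤
        {A : Finset (QuaternionGroup n) | A.card = 2 * n ∧ IsBalanced A}.ncard := by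
  have : NeZero n := ⟨by omega⟩
  refine ⟨?_, ?_, ?_⟩
  · refine le_trans ?_ (four_pow_le_ncard_isMSTD heven)
    have hlt : n + 1 ≤ 2 ^ n := Nat.lt_two_pow_self
    have h8 : 7 * 2 ^ (n - 3) - 4 ≤ 2 ^ n := by
      have : 2 ^ n = 2 ^ (n - 3) * 2 ^ 3 := by rw [← pow_add]; congr 1; omega
      omega
    calc _ ≤ 2 ^ n * 2 ^ n := Nat.mul_le_mul hlt h8
      _ = 4 ^ n := by rw [← mul_pow]; norm_num
  · exact le_trans (by omega) (four_mul_le_ncard_isMDTS (by omega))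
  · refine le_trans ?_ choose_mul_le_ncard_isBalanced
    have hsum : ∑ i ∈ (Finset.Icc 3 (n + 3)).filter (fun i => Odd i), (2 * n - i).choose (n - 3) ≤
        (n + 1) * (2 * n).choose (n - 1) := by
      refine (sum_le_card_nsmul _ _ _ fun i _ => choose_two_mul_sub_le i).trans ?_
      refine Nat.mul_le_mul_right _ ((card_filter_le _ _).trans_eq ?_)
      simp
    have hle := le_choose_two_mul_sub_one hn
    calc _ ≤ (n + 1) * ((n + 1) * (2 * n).choose (n - 1)) := Nat.mul_le_mul_left _ hsum
      _ = (2 * n).choose (n - 1) * ((n + 1) * (n + 1)) := by ring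
      _ ≤ _ := Nat.mul_le_mul_left _ (by omega)
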